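/- arXiv:2102.01018 — 5 statements merged into one kernel-verified Lean document; each statement's English description precedes it below -/
import Mathlib

section
/- Let μ ≥ 0 be an integer and let B̄ denote the infinite fixed point of ψ starting with a. The set of positions at which the word ψ^{4μ}(a) occurs as a factor of B̄ meets every residue class: for all integers m ≥ 1 and a₀, there exists a position i ≥ 0 with i ≡ a₀ (mod m) such that B̄(i+s) equals the s-th letter of ψ^{4μ}(a) for all 0 ≤ s < 16^μ (the word ψ^{4μ}(a) has length 16^μ). -/
/-- The substitution ψ on the alphabet {a,a',b,c} (encoded as `Fin 4` with
a = 0, a' = 1, b = 2, c = 3): a ↦ aa', a' ↦ bc, b ↦ aa'c, c ↦ b. -/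
def psi : Fin 4 → List (Fin 4) := ![[0, 1], [2, 3], [0, 1, 3], [2]]

/-- The infinite fixed point B̄ of ψ starting with a: the n-th letter of
ψ^k(a) for any k large enough (the word ψ^(n+1)(a) has length > n). -/
def Bbar (n : ℕ) : Fin 4 := ((fun w => w.flatMap psi)^[n + 1] [0]).getD n 0

/-- The substitution extended to words. -/
def Psi (w : List (Fin 4)) : List (Fin 4) := w.flatMap psi

/-- Number of b minus number of c. -/
def disc (w : List (Fin 4)) : ℤ := (w.count 2 : ℤ) - (w.count 3 : ℤ)

lemma Psi_append (u v : List (Fin 4)) : Psi (u ++ v) = Psi u ++ Psi v := by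
  simp [Psi]

lemma disc_append (u v : List (Fin 4)) : disc (u ++ v) = disc u + disc v := by
  simp [disc]; ring

lemma iter_append (k : ℕ) (u v : List (Fin 4)) :
    Psi^[k] (u ++ v) = Psi^[k] u ++ Psi^[k] v := by
  induction k generalizing u v with
  | zero => rfl
  | succ k ih => simp only [Function.iterate_succ_apply, Psi_append, ih]

lemma letter_facts : ∀ x : Fin 4, ((psi x).length : ℤ) = 2 + disc [x] ∧ disc (psi x) = - disc [x] := by
  decide

lemma Psi_cons (x : Fin 4) (w : List (Fin 4)) : Psi (x :: w) = psi x ++ Psi w := by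
  simp [Psi]

lemma disc_cons (x : Fin 4) (w : List (Fin 4)) : disc (x :: w) = disc [x] + disc w := by
  rw [← disc_append]; rfl

lemma len_Psi (w : List (Fin 4)) : ((Psi w).length : ℤ) = 2 * w.length + disc w := by
  induction w with
  | nil => rfl
  | cons x w ih =>
    rw [Psi_cons, disc_cons, List.length_append]
    push_cast
    rw [ih, (letter_facts x).1, List.length_cons]
    push_cast
    ring

lemma disc_Psi (w : List (Fin 4)) : disc (Psi w) = - disc w := by
  induction w with
  | nil => rfl
  | cons x w ih =>
    rw [Psi_cons, disc_cons, disc_append, ih, (letter_facts x).2]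
    ring

lemma iter_even (k : ℕ) (w : List (Fin 4)) :
    3 * ((Psi^[2 * k] w).length : ℤ) = 4 ^ k * (3 * w.length + disc w) - disc w ∧
      disc (Psi^[2 * k] w) = disc w := by
  induction k with
  | zero => simp
  | succ k ih =>
    rw [show 2 * (k + 1) = (2 * k + 1) + 1 by ring, Function.iterate_succ_apply',
      Function.iterate_succ_apply']
    simp only [len_Psi, disc_Psi, ih.2]
    refine ⟨?_, by ring⟩
    rw [pow_succ]
    linarith [ih.1]

lemma iter_zero (k : ℕ) : (Psi^[k] [0]).length = 2 ^ k ∧ disc (Psi^[k] [0]) = 0 := by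
  induction k with
  | zero => exact ⟨rfl, rfl⟩
  | succ k ih =>
    rw [Function.iterate_succ_apply']
    refine ⟨?_, by rw [disc_Psi, ih.2]; rfl⟩
    have := len_Psi (Psi^[k] [0])
    rw [ih.1, ih.2] at this
    push_cast at this
    rw [pow_succ]
    zify
    linarith

lemma prefix_iter (k t : ℕ) (h : k ≤ t) : Psi^[k] [0] <+: Psi^[t] [0] := by
  obtain ⟨d, rfl⟩ := Nat.exists_eq_add_of_le h
  clear h
  induction d with
  | zero => exact List.prefix_refl _
  | succ d ih =>
    refine ih.trans ?_
    rw [← add_assoc, Function.iterate_succ_apply]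
    have : Psi [0] = [0] ++ [1] := rfl
    rw [this, iter_append]
    exact List.prefix_append _ _

/-- `u` is a prefix of the fixed point followed by the letter a. -/
def Pre (u : List (Fin 4)) : Prop := ∃ k, u ++ [0] <+: Psi^[k] [0]

lemma pre_closure {u v : List (Fin 4)} (hu : Pre u) (k : ℕ) (hv : v ++ [0] <+: Psi^[k] [0])
    (t : ℕ) (ht : k ≤ t) : Pre (Psi^[t] u ++ v) := by
  obtain ⟨l, s, hs⟩ := hu
  obtain ⟨s', hs'⟩ := hv.trans (prefix_iter k t ht)
  refine ⟨t + l, s' ++ Psi^[t] s, ?_⟩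
  rw [Function.iterate_add_apply, ← hs, iter_append, iter_append, ← hs']
  simp

lemma exists_exp (q : ℕ) (hq : Nat.Coprime 2 q) (B : ℕ) :
    ∃ k, B ≤ k ∧ (3 * q : ℤ) ∣ 4 ^ k - 1 := by
  have hc : Nat.Coprime 4 (3 * q) := by
    have h2 : Nat.Coprime 2 (3 * q) := Nat.Coprime.mul_right (by decide) hq
    exact Nat.Coprime.pow_left 2 h2
  have hq0 : 0 < 3 * q := by
    rcases Nat.eq_zero_or_pos q with h | h
    · subst h; simp at hq
    · omega
  have h := (Nat.ModEq.pow_totient hc).pow B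
  rw [← pow_mul, one_pow] at h
  refine ⟨_, Nat.le_mul_of_pos_left B (Nat.totient_pos.2 hq0), ?_⟩
  have h3 := (Nat.modEq_iff_dvd.1 h.symm)
  push_cast at h3
  exact h3

lemma add_step (q : ℕ) (hq : Nat.Coprime 2 q) {u v : List (Fin 4)} (hu : Pre u) (hv : Pre v) :
    ∃ w, Pre w ∧ disc w = disc u + disc v ∧
      (w.length : ℤ) ≡ u.length + v.length [ZMOD q] := by
  obtain ⟨l, hl⟩ := hv
  obtain ⟨k, hk, c, hc⟩ := exists_exp q hq l
  refine ⟨_, pre_closure hu l hl (2 * k) (by omega), ?_, ?_⟩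
  · rw [disc_append, (iter_even k u).2]
  · rw [List.length_append]
    push_cast
    refine Int.ModEq.add_right _ (Int.ModEq.symm ?_)
    rw [Int.modEq_iff_dvd]
    have h := (iter_even k u).1
    refine ⟨c * (3 * u.length + disc u), ?_⟩
    have : (4 : ℤ) ^ k = 3 * q * c + 1 := by linarith
    rw [this] at h
    linarith

lemma pre_nil : Pre [] := ⟨0, List.prefix_refl _⟩

lemma pre_four : Pre [0, 1, 2, 3] := ⟨3, by decide⟩

lemma pre_thirteen : Pre [0, 1, 2, 3, 0, 1, 3, 2, 0, 1, 2, 3, 2] := ⟨4, by decide⟩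

lemma reach (q : ℕ) (hq : Nat.Coprime 2 q) (i j : ℕ) :
    ∃ w, Pre w ∧ disc w = j ∧ (w.length : ℤ) ≡ 4 * i + 13 * j [ZMOD q] := by
  induction j with
  | zero =>
    induction i with
    | zero => exact ⟨[], pre_nil, rfl, rfl⟩
    | succ i ih =>
      obtain ⟨u, hu, hd, hl⟩ := ih
      obtain ⟨w, hw, hwd, hwl⟩ := add_step q hq hu pre_four
      refine ⟨w, hw, ?_, hwl.trans ?_⟩
      · rw [hwd, hd]; rfl
      · refine (hl.add_right _).trans ?_
        simp only [List.length_cons, List.length_nil]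
        push_cast
        ring_nf
        rfl
  | succ j ih =>
    obtain ⟨u, hu, hd, hl⟩ := ih
    obtain ⟨w, hw, hwd, hwl⟩ := add_step q hq hu pre_thirteen
    refine ⟨w, hw, ?_, hwl.trans ?_⟩
    · rw [hwd, hd]; rfl
    · refine (hl.add_right _).trans ?_
      simp only [List.length_cons, List.length_nil]
      push_cast
      ring_nf
      rfl

lemma solve_lin (a n : ℕ) (hn : 0 < n) (h : Nat.Coprime a n) (c : ℤ) :
    ∃ x : ℕ, (a : ℤ) * x ≡ c [ZMOD n] := by
  have hb : (1 : ℤ) = a * a.gcdA n + n * a.gcdB n := by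
    have := Nat.gcd_eq_gcd_ab a n
    rw [h] at this
    exact_mod_cast this
  have hn' : (n : ℤ) ≠ 0 := by exact_mod_cast hn.ne'
  refine ⟨((a.gcdA n * c) % n).toNat, ?_⟩
  rw [Int.toNat_of_nonneg (Int.emod_nonneg _ hn')]
  refine ((Int.mod_modEq _ _).mul_left _).trans ?_
  rw [Int.modEq_iff_dvd]
  exact ⟨a.gcdB n * c, by linear_combination c * hb⟩

lemma getD_of_prefix {u v : List (Fin 4)} (h : u <+: v) (n : ℕ) (hn : n < u.length) :
    v.getD n 0 = u.getD n 0 := by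
  obtain ⟨s, rfl⟩ := h
  exact List.getD_append _ _ _ _ hn

lemma Bbar_eq (n k : ℕ) (hn : n < (Psi^[k] [0]).length) : Bbar n = (Psi^[k] [0]).getD n 0 := by
  change (Psi^[n + 1] [0]).getD n 0 = _
  rcases le_total k (n + 1) with h | h
  · exact getD_of_prefix (prefix_iter _ _ h) n hn
  · refine (getD_of_prefix (prefix_iter _ _ h) n ?_).symm
    rw [(iter_zero _).1]
    exact (Nat.lt_succ_self n).trans Nat.lt_two_pow_self

lemma occurs (μ N : ℕ) (hN : 4 * μ ≤ N) (u : List (Fin 4)) (hu : Pre u) (s : ℕ) (hs : s < 16 ^ μ) :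
    Bbar ((Psi^[N] u).length + s) = (Psi^[4 * μ] [0]).getD s 0 := by
  obtain ⟨k, t, ht⟩ := hu
  have hs1 : s < (Psi^[4 * μ] [0]).length := by
    rw [(iter_zero _).1, pow_mul]; exact hs
  have hp := prefix_iter _ _ hN
  have hs2 := hs1.trans_le hp.length_le
  have hpre : Psi^[N] u ++ Psi^[N] [0] <+: Psi^[N + k] [0] := by
    rw [Function.iterate_add_apply, ← ht, iter_append, iter_append]
    exact List.prefix_append _ _
  have hlt : (Psi^[N] u).length + s < (Psi^[N] u ++ Psi^[N] [0]).length := by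
    rw [List.length_append]; omega
  rw [Bbar_eq _ (N + k) (hlt.trans_le hpre.length_le), getD_of_prefix hpre _ hlt,
    List.getD_append_right _ _ _ _ (by omega), Nat.add_sub_cancel_left, getD_of_prefix hp _ hs1]

theorem psi_power_occurs_in_every_residue_class (μ : ℕ) :
    ∀ m : ℕ, 1 ≤ m → ∀ a₀ : ℤ,
      ∃ i : ℕ, (i : ℤ) ≡ a₀ [ZMOD (m : ℤ)] ∧
        ∀ s < 16 ^ μ, Bbar (i + s) = ((fun w => w.flatMap psi)^[4 * μ] [0]).getD s 0 := by
  intro m hm r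
  obtain ⟨e, q, hq, rfl⟩ := Nat.exists_eq_two_pow_mul_odd (n := m) (by omega)
  have hq0 : 0 < q := hq.pos
  have h2q : Nat.Coprime 2 q := (Nat.coprime_two_left).2 hq
  have hcop : Nat.Coprime (2 ^ e) q := Nat.Coprime.pow_left e h2q
  obtain ⟨j, hj⟩ := solve_lin q (2 ^ e) (by positivity) hcop.symm (-3 * r)
  obtain ⟨i, hi⟩ := solve_lin 4 q hq0 (Nat.Coprime.pow_left 2 h2q) r
  obtain ⟨u, hu, hd, hl⟩ := reach q h2q i (q * j)
  obtain ⟨k, hk, c, hc⟩ := exists_exp q h2q (4 * μ + e)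
  refine ⟨(Psi^[2 * k] u).length, ?_, fun s hs => occurs μ (2 * k) (by omega) u hu s hs⟩
  have h := (iter_even k u).1
  rw [hd] at h
  push_cast at h hl hj hi ⊢
  refine (Int.modEq_and_modEq_iff_modEq_mul ?_).1 ⟨?_, ?_⟩
  · simpa [Int.natAbs_pow] using hcop
  · -- modulo the power of two
    have h4 : (2 : ℤ) ^ e ∣ 4 ^ k := by
      rw [show (4 : ℤ) = 2 ^ 2 by norm_num, ← pow_mul]
      exact pow_dvd_pow _ (by omega)
    have h3 : (2 : ℤ) ^ e ∣ 3 * (r - (Psi^[2 * k] u).length) := by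
      have h5 := (Int.modEq_iff_dvd.1 hj)
      have h6 := h4.mul_right (3 * (u.length : ℤ) + q * j)
      have h7 := (dvd_add h5 h6)
      rw [← dvd_neg] at h7
      have h10 : 3 * (r - ((Psi^[2 * k] u).length : ℤ)) =
          -(-3 * r - q * j + 4 ^ k * (3 * u.length + q * j)) := by
        linear_combination -h
      rw [h10]
      exact h7
    rw [Int.modEq_iff_dvd]
    exact (IsCoprime.pow_left (by norm_num : IsCoprime (2 : ℤ) 3)).dvd_of_dvd_mul_left h3
  · -- modulo the odd part
    have h8 : (q : ℤ) ∣ (Psi^[2 * k] u).length - u.length := by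
      refine ⟨c * (3 * u.length + q * j), ?_⟩
      have : (4 : ℤ) ^ k = 3 * q * c + 1 := by linarith
      rw [this] at h
      linarith
    have h9 := (Int.modEq_iff_dvd.2 h8).symm
    refine h9.trans (hl.trans ?_)
    rw [Int.modEq_iff_dvd] at hi ⊢
    obtain ⟨d, hd'⟩ := hi
    exact ⟨d - 13 * j, by linear_combination hd'⟩
end

section
/- Let k ≥ 0 and let μ be an integer with 16^μ ≥ 2^k. For λ ≥ μ define α_λ = Σ_{ℓ=μ}^{λ−1} ( 12·16^ℓ + (4·16^ℓ − 1)/3 ) (each summand is an integer). Then the integers α_λ hit every residue class modulo 2^k as λ ranges over the integers ≥ μ: for every integer a there exists λ ≥ μ with α_λ ≡ a (mod 2^k). -/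
theorem alpha_aux (k μ : ℕ) (h : 2 ^ k ≤ 16 ^ μ) (n : ℕ) :
    (2 ^ k : ℤ) ∣ 3 * ((∑ ℓ ∈ Finset.Ico μ (μ + n),
      (12 * 16 ^ ℓ + (4 * 16 ^ ℓ - 1) / 3) : ℕ) : ℤ) + n := by
  induction n with
  | zero => simp
  | succ n ih =>
    rw [← add_assoc, Finset.sum_Ico_succ_top (by omega)]
    have e : (16 : ℕ) ^ μ = 2 ^ (4 * μ) := by rw [pow_mul]; norm_num
    have hk : k ≤ 4 * μ := by
      rw [e] at h
      exact (Nat.pow_le_pow_iff_right (by norm_num)).1 h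
    have hd : (2 ^ k : ℕ) ∣ 16 ^ (μ + n) := by
      rw [pow_add, e]
      exact Dvd.dvd.mul_right (pow_dvd_pow 2 hk) _
    have hm : (16 : ℕ) ^ (μ + n) % 3 = 1 := by
      rw [Nat.pow_mod]; simp
    have hd' : (2 ^ k : ℤ) ∣ 16 ^ (μ + n) := by exact_mod_cast hd
    generalize hS : (∑ ℓ ∈ Finset.Ico μ (μ + n),
      (12 * 16 ^ ℓ + (4 * 16 ^ ℓ - 1) / 3) : ℕ) = S at ih ⊢
    have hX : ((16 ^ (μ + n) : ℕ) : ℤ) = 16 ^ (μ + n) := by push_cast; rfl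
    rw [← hX] at hd'
    generalize (16 : ℕ) ^ (μ + n) = X at hm hd' ⊢
    have key : 3 * ((S + (12 * X + (4 * X - 1) / 3) : ℕ) : ℤ) + ((n + 1 : ℕ) : ℤ)
        = (3 * (S : ℤ) + n) + (X : ℤ) * 40 := by omega
    rw [key]
    exact dvd_add ih (Dvd.dvd.mul_right hd' _)

theorem alpha_hits_every_residue_class_mod_two_pow
    (k μ : ℕ) (h : 2 ^ k ≤ 16 ^ μ) :
    ∀ a : ℤ, ∃ lam : ℕ, μ ≤ lam ∧
      ((∑ ℓ ∈ Finset.Ico μ lam, (12 * 16 ^ ℓ + (4 * 16 ^ ℓ - 1) / 3) : ℕ) : ℤ)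
        ≡ a [ZMOD (2 ^ k : ℤ)] := by
  intro a
  have hpos : (2 ^ k : ℤ) ≠ 0 := by positivity
  have hn : (((-3 * a) % (2 ^ k : ℤ)).toNat : ℤ) = (-3 * a) % (2 ^ k : ℤ) :=
    Int.toNat_of_nonneg (Int.emod_nonneg _ hpos)
  refine ⟨μ + ((-3 * a) % (2 ^ k : ℤ)).toNat, by omega, ?_⟩
  have h1 := alpha_aux k μ h ((-3 * a) % (2 ^ k : ℤ)).toNat
  rw [hn] at h1
  generalize ((∑ ℓ ∈ Finset.Ico μ (μ + ((-3 * a) % (2 ^ k : ℤ)).toNat),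
      (12 * 16 ^ ℓ + (4 * 16 ^ ℓ - 1) / 3) : ℕ) : ℤ) = S at h1 ⊢
  have h2 : (2 ^ k : ℤ) ∣ (-3 * a) - (-3 * a) % (2 ^ k : ℤ) := Int.dvd_self_sub_emod
  have h3 : (2 ^ k : ℤ) ∣ 3 * (a - S) := by
    have := dvd_add h1 h2
    rw [← dvd_neg]
    convert this using 1
    ring
  have hc : IsCoprime (2 ^ k : ℤ) 3 := IsCoprime.pow_left ⟨-1, 1, by norm_num⟩
  exact Int.modEq_iff_dvd.2 (hc.dvd_of_dvd_mul_left h3)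
end

section
/- Let λ ≥ 0 be an integer, and let d ≥ 1 be an odd integer and a an integer. Let W_λ be the set of nonnegative multiples of 16^λ all of whose digits in base 16 lie in {0, 4, 8}. Then the set W_λ ∩ { n : n ≡ a (mod d) } is infinite. -/
lemma good_step (n r : ℕ) (hr : r = 0 ∨ r = 4)
    (h : ∀ c ∈ Nat.digits 16 n, c = 0 ∨ c = 4 ∨ c = 8) :
    ∀ c ∈ Nat.digits 16 (16 * n + r), c = 0 ∨ c = 4 ∨ c = 8 := by
  rcases Nat.eq_zero_or_pos (16 * n + r) with h0 | h0
  · rw [h0]; simp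
  · rw [Nat.digits_def' (by norm_num) h0]
    have h1 : (16 * n + r) % 16 = r := by omega
    have h2 : (16 * n + r) / 16 = n := by omega
    rw [h1, h2]
    intro c hc
    rcases List.mem_cons.1 hc with rfl | hc
    · tauto
    · exact h c hc

lemma good_pow (e n : ℕ)
    (h : ∀ c ∈ Nat.digits 16 n, c = 0 ∨ c = 4 ∨ c = 8) :
    ∀ c ∈ Nat.digits 16 (16 ^ e * n), c = 0 ∨ c = 4 ∨ c = 8 := by
  induction e with
  | zero => simpa using h
  | succ e ih =>
    have := good_step _ 0 (Or.inl rfl) ih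
    rwa [add_zero, ← mul_assoc, ← pow_succ'] at this

lemma good_exists (d : ℤ) (e : ℕ) (he : (16 : ℤ) ^ (e + 1) ≡ 1 [ZMOD d]) (k : ℕ) :
    ∃ m : ℕ, k ≤ m ∧ (∀ c ∈ Nat.digits 16 m, c = 0 ∨ c = 4 ∨ c = 8) ∧
      (m : ℤ) ≡ 4 * k [ZMOD d] := by
  induction k with
  | zero => exact ⟨0, le_rfl, by simp, by simp [Int.ModEq.refl]⟩
  | succ k ih =>
    obtain ⟨m, h1, h2, h3⟩ := ih
    refine ⟨16 * (16 ^ e * m) + 4, ?_, good_step _ 4 (Or.inr rfl) (good_pow e m h2), ?_⟩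
    · have : m ≤ 16 ^ e * m := Nat.le_mul_of_pos_left _ (by positivity)
      omega
    · have := (he.mul h3).add_right 4
      push_cast
      convert this using 1 <;> ring

theorem missing_digit_multiples_in_residue_class_infinite
    (lam : ℕ) (d : ℤ) (hd1 : 1 ≤ d) (hodd : Odd d) (a : ℤ) :
    {n : ℕ | 16 ^ lam ∣ n ∧ (∀ c ∈ Nat.digits 16 n, c = 0 ∨ c = 4 ∨ c = 8) ∧
      (n : ℤ) ≡ a [ZMOD d]}.Infinite := by
  obtain ⟨D, rfl⟩ := Int.eq_ofNat_of_zero_le (by omega : 0 ≤ d)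
  have hD : Odd D := by exact_mod_cast hodd
  have hc : Nat.Coprime 2 D := Nat.coprime_two_left.2 hD
  have h16 : Nat.Coprime 16 D := by
    simpa using hc.pow_left 4
  have h4 : Nat.Coprime 4 D := by
    simpa using hc.pow_left 2
  have hphi : 0 < Nat.totient D := Nat.totient_pos.2 (by omega)
  obtain ⟨e, hphi'⟩ : ∃ e, Nat.totient D = e + 1 := ⟨Nat.totient D - 1, by omega⟩
  have he : (16 : ℤ) ^ (e + 1) ≡ 1 [ZMOD (D : ℤ)] := by
    have := Nat.ModEq.pow_totient h16
    rw [hphi'] at this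
    exact_mod_cast (Int.natCast_modEq_iff.2 this)
  obtain ⟨x, hx⟩ : ∃ x : ℤ, 4 * x ≡ 1 [ZMOD (D : ℤ)] := by
    have := Int.mod_coprime h4
    exact_mod_cast this
  apply Set.infinite_of_forall_exists_gt
  intro N
  have hnn : 0 ≤ (x * a) % (D : ℤ) := Int.emod_nonneg _ (by omega)
  obtain ⟨r, hr⟩ := Int.eq_ofNat_of_zero_le hnn
  obtain ⟨m, h1, h2, h3⟩ := good_exists D e he (r + D * (N + 1))
  have hNm : N < m := by
    have : 1 * (N + 1) ≤ D * (N + 1) := Nat.mul_le_mul_right _ (by omega)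
    omega
  refine ⟨16 ^ ((e + 1) * lam) * m, ⟨?_, good_pow _ _ h2, ?_⟩, ?_⟩
  · exact Dvd.dvd.mul_right (pow_dvd_pow _ (Nat.le_mul_of_pos_left _ (by omega))) _
  · have hp : (16 : ℤ) ^ ((e + 1) * lam) ≡ 1 [ZMOD (D : ℤ)] := by
      rw [pow_mul]
      simpa using he.pow lam
    have hrm : (r : ℤ) ≡ x * a [ZMOD (D : ℤ)] := by
      have := Int.mod_modEq (x * a) D
      rwa [hr] at this
    have hk : ((r + D * (N + 1) : ℕ) : ℤ) ≡ x * a [ZMOD (D : ℤ)] := by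
      push_cast
      refine Int.ModEq.trans ?_ hrm
      exact (Int.modEq_iff_dvd.2 ⟨-(N + 1), by ring⟩)
    push_cast
    calc (16 : ℤ) ^ ((e + 1) * lam) * m ≡ 1 * (4 * (x * a)) [ZMOD (D : ℤ)] :=
          hp.mul (h3.trans (hk.mul_left 4))
      _ = 4 * x * a := by ring
      _ ≡ 1 * a [ZMOD (D : ℤ)] := hx.mul_right a
      _ = a := one_mul a
  · exact lt_of_lt_of_le hNm (Nat.le_mul_of_pos_left _ (by positivity))
end

section
/- Let d ≥ 1 be an odd integer, let ℓ be an integer with 1 ≤ ℓ < d, and let λ ≥ 0. Define U(x) = (1/3)·(1 + e(4x) + e(8x)) for real x, where e(x) = exp(2πix). Then the products G(ν) = ∏_{r=λ}^{ν−1} U(16^r · ℓ/d) tend to 0 as ν → ∞. -/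
/-- `e x = exp(2πix)`. -/
noncomputable def eFun (x : ℝ) : ℂ := Complex.exp (2 * Real.pi * Complex.I * x)

/-- `U x = (1 + e(4x) + e(8x))/3`. -/
noncomputable def Ufun (x : ℝ) : ℂ := (1 + eFun (4 * x) + eFun (8 * x)) / 3

lemma aux_norm_lt (z : ℂ) (hz : ‖z‖ = 1) (h1 : z ≠ 1) : ‖(1 + z + z ^ 2) / 3‖ < 1 := by
  have hsq : z.re * z.re + z.im * z.im = 1 := by
    have := Complex.normSq_eq_norm_sq z
    rw [Complex.normSq_apply, hz] at this
    linarith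
  have hre : z.re < 1 := by
    by_contra hcon
    push Not at hcon
    have him : z.im = 0 := by nlinarith [sq_nonneg z.im]
    have hr : z.re = 1 := by nlinarith [sq_nonneg z.im]
    exact h1 (Complex.ext (by simpa using hr) (by simpa using him))
  have h2 : ‖1 + z‖ < 2 := by
    have := Complex.normSq_eq_norm_sq (1 + z)
    rw [Complex.normSq_apply] at this
    simp only [Complex.add_re, Complex.one_re, Complex.add_im, Complex.one_im] at this
    nlinarith [norm_nonneg (1 + z)]
  have h3 : ‖1 + z + z ^ 2‖ ≤ ‖1 + z‖ + 1 := by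
    refine (norm_add_le _ _).trans ?_
    rw [norm_pow, hz]; norm_num
  rw [norm_div]
  have : ‖(3 : ℂ)‖ = 3 := by simp
  rw [this]
  linarith

lemma aux_unif (n : ℕ) (hn : 0 < n) :
    ∃ c : ℝ, 0 ≤ c ∧ c < 1 ∧ ∀ z : ℂ, z ^ n = 1 → z ≠ 1 → ‖(1 + z + z ^ 2) / 3‖ ≤ c := by
  classical
  let S := (Polynomial.nthRootsFinset n (1 : ℂ)).erase 1
  have hS : ∀ z : ℂ, z ∈ S ↔ z ≠ 1 ∧ z ^ n = 1 := by
    intro z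
    simp [S, Polynomial.mem_nthRootsFinset hn]
  by_cases hne : S.Nonempty
  · obtain ⟨w, hw, hmax⟩ := S.exists_max_image (fun z => ‖(1 + z + z ^ 2) / 3‖) hne
    refine ⟨_, norm_nonneg _, aux_norm_lt w ?_ ((hS w).1 hw).1,
      fun z hz h1 => hmax z ((hS z).2 ⟨h1, hz⟩)⟩
    exact Complex.norm_eq_one_of_pow_eq_one ((hS w).1 hw).2 hn.ne'
  · refine ⟨0, le_rfl, one_pos, fun z hz h1 => ?_⟩
    exact absurd ⟨z, (hS z).2 ⟨h1, hz⟩⟩ hne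

theorem product_of_U_tendsto_zero
    (d ℓ : ℤ) (hd1 : 1 ≤ d) (hodd : Odd d) (hℓ1 : 1 ≤ ℓ) (hℓd : ℓ < d) (lam : ℕ) :
    Filter.Tendsto
      (fun ν : ℕ => ∏ r ∈ Finset.Ico lam ν, Ufun (16 ^ r * ((ℓ : ℝ) / (d : ℝ))))
      Filter.atTop (nhds 0) := by
  obtain ⟨n, rfl⟩ := Int.eq_ofNat_of_zero_le (by omega : 0 ≤ d)
  have hn : 0 < n := by omega
  have hnC : (n : ℂ) ≠ 0 := by exact_mod_cast hn.ne'
  obtain ⟨c, hc0, hc1, hc⟩ := aux_unif n hn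
  have hb : ∀ r : ℕ, ‖Ufun (16 ^ r * ((ℓ : ℝ) / (((n : ℤ)) : ℝ)))‖ ≤ c := by
    intro r
    set x : ℝ := 16 ^ r * ((ℓ : ℝ) / (((n : ℤ)) : ℝ)) with hx
    have hU : Ufun x = (1 + eFun (4 * x) + eFun (4 * x) ^ 2) / 3 := by
      unfold Ufun eFun
      rw [← Complex.exp_nat_mul]
      congr 3
      push_cast
      ring
    rw [hU]
    apply hc
    · unfold eFun
      rw [← Complex.exp_nat_mul, Complex.exp_eq_one_iff]
      refine ⟨4 * 16 ^ r * ℓ, ?_⟩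
      rw [hx]
      push_cast
      field_simp
    · intro h
      unfold eFun at h
      rw [Complex.exp_eq_one_iff] at h
      obtain ⟨k, hk⟩ := h
      have h2 : (4 * 16 ^ r * ℓ : ℂ) = n * k := by
        have hpi : (2 * Real.pi * Complex.I : ℂ) ≠ 0 := Complex.two_pi_I_ne_zero
        have h3 : ((4 * x : ℝ) : ℂ) = k := by
          apply mul_left_cancel₀ hpi
          rw [hk]; ring
        rw [← h3, hx]
        push_cast
        field_simp
      have h4 : (4 * 16 ^ r * ℓ : ℤ) = n * k := by exact_mod_cast h2
      have hdvd : (n : ℤ) ∣ 2 ^ (2 + 4 * r) * ℓ := by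
        refine ⟨k, ?_⟩
        rw [← h4, pow_add, pow_mul]; norm_num
      have hcop : IsCoprime (n : ℤ) (2 ^ (2 + 4 * r)) := by
        apply IsCoprime.pow_right
        obtain ⟨m, hm⟩ := hodd
        exact ⟨1, -m, by rw [hm]; ring⟩
      have := Int.le_of_dvd (by omega) (hcop.dvd_of_dvd_mul_left hdvd)
      omega
  apply squeeze_zero_norm (a := fun ν => c ^ (ν - lam))
  · intro ν
    rw [norm_prod]
    calc _ ≤ ∏ r ∈ Finset.Ico lam ν, c :=
          Finset.prod_le_prod (fun _ _ => norm_nonneg _) (fun r _ => hb r)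
      _ = _ := by simp
  · exact (tendsto_pow_atTop_nhds_zero_of_lt_one hc0 hc1).comp (Filter.tendsto_sub_atTop_nat lam)
end

section
/- The ternary Thue–Morse sequence A, the fixed point of φ starting with a, is squarefree: for every k ≥ 0, the finite word φ^k(a) contains no factor of the form uu with u a nonempty word. Equivalently, for all i ≥ 0 and L ≥ 1 there exists 0 ≤ s < L with A(i+s) ≠ A(i+L+s). -/
/-- The substitution φ on the alphabet {a,b,c} (encoded as `Fin 3` with
a = 0, b = 1, c = 2): a ↦ abc, b ↦ ac, c ↦ b. -/
def phi : Fin 3 → List (Fin 3) := ![[0, 1, 2], [0, 2], [1]]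

/-- The ternary Thue–Morse sequence A, the infinite fixed point of φ starting
with a: the n-th letter of φ^k(a) for any k large enough (the word
φ^(n+1)(a) has length > n). -/
def ternTM (n : ℕ) : Fin 3 := ((fun w => w.flatMap phi)^[n + 1] [0]).getD n 0

/-- The Thue–Morse sequence. -/
def tmB : ℕ → Bool
  | 0 => false
  | n + 1 => xor (tmB ((n + 1) / 2)) (decide ((n + 1) % 2 = 1))
decreasing_by omega

lemma tmB_even (n : ℕ) : tmB (2 * n) = tmB n := by
  cases n with
  | zero => rfl
  | succ n =>
    rw [show 2 * (n + 1) = (2 * n + 1) + 1 by ring, tmB]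
    rw [show (2 * n + 1 + 1) / 2 = n + 1 by omega, show (2 * n + 1 + 1) % 2 = 0 by omega]
    simp

lemma tmB_odd (n : ℕ) : tmB (2 * n + 1) = !tmB n := by
  rw [tmB, show (2 * n + 1) / 2 = n by omega, show (2 * n + 1) % 2 = 1 by omega]
  simp

/-- Coding of a pair of consecutive Thue–Morse letters (difference sequence). -/
def codeB : Bool → Bool → Fin 3
  | false, true => 0
  | true, false => 2
  | _, _ => 1

/-- Difference sequence of Thue–Morse. -/
def diffB (n : ℕ) : Fin 3 := codeB (tmB n) (tmB (n + 1))

/-- Length of the image of a prefix of length `n`. -/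
def lenB (n : ℕ) : ℕ := 2 * n + (tmB n).toNat

lemma flatMap_prefix (n : ℕ) :
    ((List.range n).map diffB).flatMap phi = (List.range (lenB n)).map diffB := by
  induction n with
  | zero => simp [lenB, tmB]
  | succ n ih =>
    rw [List.range_succ, List.map_append, List.flatMap_append, ih]
    have e0 := tmB_even n
    have o0 := tmB_odd n
    have e1 : tmB (2 * n + 2) = tmB (n + 1) := tmB_even (n + 1)
    have o1 : tmB (2 * n + 3) = !tmB (n + 1) := tmB_odd (n + 1)
    cases h0 : tmB n <;> cases h1 : tmB (n + 1) <;> rw [h0] at e0 o0 <;> rw [h1] at e1 o1 <;>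
      simp [lenB, h0, h1, diffB, codeB, phi, List.range_succ, mul_add, e0, o0, e1, o1]

lemma iterate_prefix (k : ℕ) :
    ∃ m, k < m ∧ (fun w : List (Fin 3) => w.flatMap phi)^[k] [0] = (List.range m).map diffB := by
  induction k with
  | zero => exact ⟨1, by omega, by simp [diffB, tmB, codeB]⟩
  | succ k ih =>
    obtain ⟨m, hm, h⟩ := ih
    refine ⟨lenB m, by unfold lenB; omega, ?_⟩
    rw [Function.iterate_succ_apply', h]
    exact flatMap_prefix m

lemma ternTM_eq (n : ℕ) : ternTM n = diffB n := by
  obtain ⟨m, hm, h⟩ := iterate_prefix (n + 1)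
  have hn : n < m := by omega
  rw [ternTM, h]
  simp [List.getD, hn]

lemma tmB_overlap_free (L : ℕ) : 1 ≤ L → ∀ i, ¬ ∀ s ≤ L, tmB (i + s) = tmB (i + L + s) := by
  induction L using Nat.strong_induction_on with
  | _ L ih =>
  intro hL i h
  rcases Nat.even_or_odd' L with ⟨M, rfl | rfl⟩
  · rcases Nat.even_or_odd' i with ⟨j, rfl | rfl⟩
    · refine ih M (by omega) (by omega) j fun s hs => ?_
      have := h (2 * s) (by omega)
      rwa [show 2 * j + 2 * s = 2 * (j + s) by ring,
        show 2 * j + 2 * M + 2 * s = 2 * (j + M + s) by ring, tmB_even, tmB_even] at this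
    · refine ih M (by omega) (by omega) j fun s hs => ?_
      have := h (2 * s) (by omega)
      rw [show 2 * j + 1 + 2 * s = 2 * (j + s) + 1 by ring,
        show 2 * j + 1 + 2 * M + 2 * s = 2 * (j + M + s) + 1 by ring, tmB_odd, tmB_odd] at this
      simpa using this
  · -- an equal adjacent pair cannot start at an even position
    have key : ∀ m, tmB (2 * m) ≠ tmB (2 * m + 1) := by
      intro m
      rw [tmB_even, tmB_odd]
      cases tmB m <;> simp
    have alt : ∀ s < 2 * M + 1, tmB (i + s + 1) = !tmB (i + s) := by
      intro s hs
      by_contra hne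
      have heq : tmB (i + s) = tmB (i + s + 1) := by
        revert hne
        cases tmB (i + s) <;> cases tmB (i + s + 1) <;> simp
      have h1 := h s (by omega)
      have h2 := h (s + 1) (by omega)
      rw [← add_assoc, ← add_assoc] at h2
      rcases Nat.even_or_odd' (i + s) with ⟨j, hj | hj⟩
      · rw [hj] at heq
        exact key j heq
      · rw [show i + (2 * M + 1) + s = 2 * (j + M + 1) by omega] at h1 h2
        exact key (j + M + 1) (by rw [← h1, ← h2, heq])
    have alt2 : ∀ r ≤ M, tmB (i + 2 * r) = tmB i := by
      intro r
      induction r with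
      | zero => simp
      | succ r ihr =>
        intro hr
        have a := alt (2 * r) (by omega)
        have b := alt (2 * r + 1) (by omega)
        rw [← add_assoc] at b
        rw [show i + 2 * (r + 1) = i + 2 * r + 1 + 1 by ring, b, a, Bool.not_not]
        exact ihr (by omega)
    have a := alt (2 * M) (by omega)
    rw [alt2 M le_rfl] at a
    have b := h 0 (by omega)
    simp only [add_zero] at b
    rw [← add_assoc, a] at b
    cases hb : tmB i <;> simp [hb] at b

theorem ternary_thueMorse_squarefree :
    ∀ i L : ℕ, 1 ≤ L → ∃ s < L, ternTM (i + s) ≠ ternTM (i + L + s) := by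
  intro i L hL
  by_contra! hcon
  have h : ∀ s < L, codeB (tmB (i + s)) (tmB (i + s + 1)) =
      codeB (tmB (i + L + s)) (tmB (i + L + s + 1)) := by
    intro s hs
    have := hcon s hs
    rwa [ternTM_eq, ternTM_eq] at this
  by_cases h0 : tmB i = tmB (i + L)
  · refine tmB_overlap_free L hL i fun s => ?_
    induction s with
    | zero => simpa using h0
    | succ s ihs =>
      intro hs
      have h1 := ihs (by omega)
      have h2 := h s (by omega)
      rw [h1] at h2
      rw [← add_assoc, ← add_assoc]
      revert h2
      cases tmB (i + L + s) <;> cases tmB (i + s + 1) <;> cases tmB (i + L + s + 1) <;>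
        simp [codeB]
  · -- the two blocks are complementary and constant
    have hk : ∀ s ≤ L, tmB (i + s) = tmB i ∧ tmB (i + L + s) = tmB (i + L) := by
      intro s
      induction s with
      | zero => simp
      | succ s ihs =>
        intro hs
        obtain ⟨h1, h1'⟩ := ihs (by omega)
        have h2 := h s (by omega)
        rw [h1, h1'] at h2
        rw [← add_assoc, ← add_assoc]
        revert h2 h0
        cases tmB i <;> cases tmB (i + L) <;> cases tmB (i + s + 1) <;>
          cases tmB (i + L + s + 1) <;> simp [codeB]
    exact h0 (hk L le_rfl).1.symm
end
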